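/- arXiv:0811.3055 — 2 statements merged into one kernel-verified Lean document; each statement's English description precedes it below -/
import Mathlib

section
/- Let α > 0, p ∈ (0,1), integer k ≥ 2 be constants and let r_bf = −α/(k ln(1−p)). If r > r_bf, then the probability that a random instance of Model RD is backtrack-free tends to 0 as n → ∞. -/
/-- Sample space for a random instance of Model RD with `n` variables, domain `Fin d`,
`m` constraints, each constraint scope a `k`-element set of variables: the first component
gives the scopes, the second gives, for each constraint, a boolean flag for every partial
assignment (the flags indexed by partial assignments supported exactly on the scope
determine which scope-assignments are compatible). -/
abbrev RDOmega (n d m k : ℕ) :=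
  (Fin m → {S : Finset (Fin n) // S.card = k}) × (Fin m → (Fin n → Option (Fin d)) → Bool)

/-- The probability weight of an outcome: scopes are uniform among `k`-element subsets,
and each flag is `true` independently with probability `1 - p`. -/
noncomputable def rdWeight (p : ℝ) {n d m k : ℕ} (ω : RDOmega n d m k) : ℝ :=
  ((Fintype.card {S : Finset (Fin n) // S.card = k} : ℝ))⁻¹ ^ m *
    ∏ i : Fin m, ∏ g : Fin n → Option (Fin d), (if ω.2 i g then 1 - p else p)

/-- The probability of an event for Model RD. -/
noncomputable def rdPr (p : ℝ) (n d m k : ℕ) (E : RDOmega n d m k → Prop) : ℝ :=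
  haveI : DecidablePred E := Classical.decPred E
  ∑ ω ∈ Finset.univ.filter E, rdWeight p ω

/-- The (total) assignment `c` is compatible with constraint `i`: the flag of the
restriction of `c` to the scope of `i` is `true`. Since only the restriction of `c` to
the scope is consulted, this expresses compatibility of any partial assignment defined on
a superset of the scope. -/
def rdCompat {n d m k : ℕ} (ω : RDOmega n d m k) (i : Fin m) (c : Fin n → Fin d) : Prop :=
  ω.2 i (fun v => if v ∈ (ω.1 i).1 then some (c v) else none) = true

/-- The random instance `ω` of Model RD is backtrack-free: there is an ordering
`π 0 < π 1 < ...` of the variables such that every partial assignment on an initial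
segment compatible with all constraints whose scope lies in that segment extends to the
next variable compatibly with all constraints whose scope lies in the extended segment. -/
def rdBacktrackFree {n d m k : ℕ} (ω : RDOmega n d m k) : Prop :=
  ∃ π : Equiv.Perm (Fin n), ∀ i : Fin n, ∀ c : Fin n → Fin d,
    (∀ j, (ω.1 j).1 ⊆ (Finset.Iio i).image π → rdCompat ω j c) →
    ∃ v : Fin d, ∀ j, (ω.1 j).1 ⊆ (Finset.Iic i).image π →
      rdCompat ω j (Function.update c (π i) v)

namespace ModelRD

open Finset

/-- Every assignment compatible with all constraints whose scope lies in `A`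
extends off `A` to a solution, and at least one such assignment exists. -/
def ExtendsFrom {n d m k : ℕ} (A : Finset (Fin n)) (ω : RDOmega n d m k) : Prop :=
  (∃ c : Fin n → Fin d, ∀ j, (ω.1 j).1 ⊆ A → rdCompat ω j c) ∧
    ∀ c : Fin n → Fin d, (∀ j, (ω.1 j).1 ⊆ A → rdCompat ω j c) →
      ∃ c' : Fin n → Fin d, (∀ w ∈ A, c' w = c w) ∧ ∀ j, rdCompat ω j c'

/-- The scope `S` consists of one variable of `B` and otherwise of variables in `A`. -/
def Attached {n : ℕ} (A B S : Finset (Fin n)) : Prop :=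
  ∃ u ∈ B, u ∈ S ∧ S ⊆ insert u A

section Deterministic

variable {n d m k : ℕ}

lemma rdCompat_congr {ω : RDOmega n d m k} {j : Fin m} {c c' : Fin n → Fin d}
    (h : ∀ w ∈ (ω.1 j).1, c w = c' w) : rdCompat ω j c ↔ rdCompat ω j c' := by
  unfold rdCompat
  have : (fun v => if v ∈ (ω.1 j).1 then some (c v) else none) =
      fun v => if v ∈ (ω.1 j).1 then some (c' v) else none := by
    funext v
    split_ifs with hv
    · rw [h v hv]
    · rfl
  rw [this]

/-- The first `t` variables of the ordering `π`. -/
def initialSegment (π : Equiv.Perm (Fin n)) (t : ℕ) : Finset (Fin n) :=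
  (univ.filter fun i : Fin n => i.val < t).image π

lemma card_initialSegment (π : Equiv.Perm (Fin n)) {t : ℕ} (ht : t ≤ n) :
    (initialSegment π t).card = t := by
  rw [initialSegment, card_image_of_injective _ π.injective, Fin.card_filter_val_lt]
  omega

lemma exists_extendsFrom_of_backtrackFree {ω : RDOmega n d m k} (hω : rdBacktrackFree ω)
    (hk : 1 ≤ k) (hd : 0 < d) {t : ℕ} (ht : t ≤ n) :
    ∃ A : Finset (Fin n), A.card = t ∧ ExtendsFrom A ω := by
  obtain ⟨π, hπ⟩ := hω
  have hIio (i : Fin n) : (Iio i).image π = initialSegment π i.val := by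
    refine congrArg (image π) ?_
    ext x
    rw [mem_Iio, mem_filter]
    exact ⟨fun h => ⟨mem_univ _, h⟩, fun h => h.2⟩
  have hIic (i : Fin n) : (Iic i).image π = initialSegment π (i.val + 1) := by
    refine congrArg (image π) ?_
    ext x
    rw [mem_Iic, mem_filter]
    exact ⟨fun h => ⟨mem_univ _, Nat.lt_succ_of_le h⟩, fun h => Nat.le_of_lt_succ h.2⟩
  have key (a : ℕ) (c : Fin n → Fin d)
      (hc : ∀ j, (ω.1 j).1 ⊆ initialSegment π a → rdCompat ω j c) (b : ℕ) (hb : a + b ≤ n) :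
      ∃ c' : Fin n → Fin d, (∀ w ∈ initialSegment π a, c' w = c w) ∧
        ∀ j, (ω.1 j).1 ⊆ initialSegment π (a + b) → rdCompat ω j c' := by
    induction b with
    | zero => exact ⟨c, fun _ _ => rfl, hc⟩
    | succ b ih =>
      obtain ⟨c', h1, h2⟩ := ih (by omega)
      let i : Fin n := ⟨a + b, by omega⟩
      obtain ⟨v, hv⟩ := hπ i c' (by rw [hIio]; exact h2)
      refine ⟨Function.update c' (π i) v, fun w hw => ?_, ?_⟩
      · rw [Function.update_of_ne, h1 w hw]
        rintro rfl
        obtain ⟨x, hx, hxi⟩ := mem_image.1 hw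
        have : x = i := π.injective hxi
        subst this
        simp [i] at hx
      · rw [hIic] at hv
        exact hv
  have hfull : initialSegment π n = univ := by
    rw [← card_eq_iff_eq_univ, card_initialSegment π le_rfl, Fintype.card_fin]
  refine ⟨initialSegment π t, card_initialSegment π ht, ?_, fun c hc => ?_⟩
  · obtain ⟨c, -, hc⟩ := key 0 (fun _ => ⟨0, hd⟩) (fun j hj => by
      have h1 := card_le_card hj
      rw [card_initialSegment π (Nat.zero_le n), (ω.1 j).2] at h1
      omega) t (by omega)
    rw [zero_add] at hc
    exact ⟨c, hc⟩
  · obtain ⟨c', h1, h2⟩ := key t c hc (n - t) (by omega)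
    refine ⟨c', h1, fun j => h2 j ?_⟩
    rw [Nat.add_sub_cancel' ht, hfull]
    exact subset_univ _

end Deterministic

section Flags

variable {p : ℝ}

/-- The weight of a family of independent flags, each `true` with weight `1 - p`. -/
noncomputable def flagWeight (p : ℝ) {β : Type*} [Fintype β] (x : β → Bool) : ℝ :=
  ∏ g, if x g then 1 - p else p

lemma flagWeight_nonneg (hp0 : 0 ≤ p) (hp1 : p ≤ 1) {β : Type*} [Fintype β] (x : β → Bool) :
    0 ≤ flagWeight p x := by
  refine prod_nonneg fun g _ => ?_
  split_ifs <;> linarith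

lemma sum_flagWeight {β : Type*} [Fintype β] [DecidableEq β] :
    ∑ x : β → Bool, flagWeight p x = 1 := by
  unfold flagWeight
  rw [← Fintype.prod_sum (fun (_ : β) (b : Bool) => if b then 1 - p else p)]
  simp

lemma sum_flagWeight_true {β : Type*} [Fintype β] [DecidableEq β] (g₀ : β) :
    ∑ x : β → Bool, flagWeight p x * (if x g₀ = true then 1 else 0) = 1 - p := by
  have h (x : β → Bool) : flagWeight p x * (if x g₀ = true then 1 else 0) =
      ∏ g, (if x g then 1 - p else p) * (if g = g₀ then (if x g then 1 else 0) else 1) := by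
    rw [prod_mul_distrib, flagWeight, prod_ite_eq' univ g₀]
    simp
  rw [sum_congr rfl fun x _ => h x,
    ← Fintype.prod_sum (fun (g : β) (b : Bool) =>
      (if b then 1 - p else p) * (if g = g₀ then (if b then 1 else 0) else 1)),
    prod_eq_single g₀]
  · simp
  · intro g _ hg
    simp [hg]
  · simp

/-- A bound on a conditional expectation which is uniform in the rows conditioned on
bounds the whole expectation. -/
lemma sum_prod_mul_le_of_forall {ι ρ : Type*} [Fintype ι] [DecidableEq ι] [Fintype ρ]
    {W : ρ → ℝ} (hW0 : ∀ x, 0 ≤ W x) (hW1 : ∑ x, W x = 1) (P : ι → Prop) [DecidablePred P]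
    (F : (ι → ρ) → ℝ) (C : ℝ)
    (h : ∀ f₁ : {j // P j} → ρ, ∑ f₂ : {j // ¬ P j} → ρ, (∏ j, W (f₂ j)) *
      F (fun j => if hj : P j then f₁ ⟨j, hj⟩ else f₂ ⟨j, hj⟩) ≤ C) :
    ∑ f : ι → ρ, (∏ j, W (f j)) * F f ≤ C := by
  rw [← (Equiv.piEquivPiSubtypeProd P fun _ => ρ).symm.sum_comp, Fintype.sum_prod_type]
  have hsplit (f₁ : {j // P j} → ρ) (f₂ : {j // ¬ P j} → ρ) :
      (∏ j, W ((Equiv.piEquivPiSubtypeProd P fun _ => ρ).symm (f₁, f₂) j)) =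
        (∏ j, W (f₁ j)) * ∏ j, W (f₂ j) := by
    rw [← Fintype.prod_subtype_mul_prod_subtype P]
    congr 1
    · exact prod_congr rfl fun j _ => by simp [Equiv.piEquivPiSubtypeProd_symm_apply, j.2]
    · exact prod_congr rfl fun j _ => by simp [Equiv.piEquivPiSubtypeProd_symm_apply, j.2]
  calc _ = ∑ f₁ : {j // P j} → ρ, (∏ j, W (f₁ j)) * ∑ f₂ : {j // ¬ P j} → ρ, (∏ j, W (f₂ j)) *
        F (fun j => if hj : P j then f₁ ⟨j, hj⟩ else f₂ ⟨j, hj⟩) := by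
        refine sum_congr rfl fun f₁ _ => ?_
        rw [mul_sum]
        refine sum_congr rfl fun f₂ _ => ?_
        rw [hsplit, mul_assoc]
        rfl
    _ ≤ ∑ f₁ : {j // P j} → ρ, (∏ j, W (f₁ j)) * C :=
        sum_le_sum fun f₁ _ => mul_le_mul_of_nonneg_left (h f₁) (prod_nonneg fun _ _ => hW0 _)
    _ = C := by
        rw [← sum_mul, ← Fintype.prod_sum (fun (_ : {j // P j}) (x : ρ) => W x)]
        simp [hW1]

open Classical in
/-- Given the scopes, the probability that one fixed compatible assignment on `A` extends
to the variables of `B`. -/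
lemma sum_flags_extendsFrom_le {n d m k : ℕ} (hp0 : 0 ≤ p) (hp1 : p ≤ 1)
    {A B : Finset (Fin n)} (hAB : Disjoint A B) (s : Fin m → {S : Finset (Fin n) // S.card = k}) :
    ∑ f : Fin m → (Fin n → Option (Fin d)) → Bool, (∏ j, flagWeight p (f j)) *
        (if ExtendsFrom A ((s, f) : RDOmega n d m k) then 1 else 0) ≤
      (d : ℝ) ^ B.card * ∏ j, (if Attached A B (s j).1 then 1 - p else 1) := by
  have hprod0 (j : Fin m) : 0 ≤ (if Attached A B (s j).1 then 1 - p else 1) := by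
    split_ifs <;> linarith
  refine sum_prod_mul_le_of_forall (flagWeight_nonneg hp0 hp1) sum_flagWeight
    (fun j => (s j).1 ⊆ A) _ _ fun f₁ => ?_
  let R (c : Fin n → Fin d) (j : Fin m) : Fin n → Option (Fin d) :=
    fun v => if v ∈ (s j).1 then some (c v) else none
  let comb (f₂ : {j // ¬ (s j).1 ⊆ A} → (Fin n → Option (Fin d)) → Bool) :
      Fin m → (Fin n → Option (Fin d)) → Bool :=
    fun j => if hj : (s j).1 ⊆ A then f₁ ⟨j, hj⟩ else f₂ ⟨j, hj⟩
  by_cases hc : ∃ c : Fin n → Fin d, ∀ j : {j // (s j).1 ⊆ A}, f₁ j (R c j) = true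
  swap
  · have hno (f₂) : ¬ ExtendsFrom A ((s, comb f₂) : RDOmega n d m k) := by
      rintro ⟨⟨c, hc'⟩, -⟩
      refine hc ⟨c, fun j => ?_⟩
      have := hc' j.1 j.2
      simpa [rdCompat, comb, j.2] using this
    rw [sum_eq_zero fun f₂ _ => ?_]
    · exact mul_nonneg (by positivity) (prod_nonneg fun j _ => hprod0 j)
    · change _ * (if ExtendsFrom A ((s, comb f₂) : RDOmega n d m k) then (1 : ℝ) else 0) = 0
      rw [if_neg (hno f₂), mul_zero]
  obtain ⟨c, hc⟩ := hc
  let ext (v : B → Fin d) : Fin n → Fin d := fun w => if hw : w ∈ B then v ⟨w, hw⟩ else c w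
  let ind (v : B → Fin d) (j : {j // ¬ (s j).1 ⊆ A}) (x : (Fin n → Option (Fin d)) → Bool) : ℝ :=
    if Attached A B (s j).1 then (if x (R (ext v) j) = true then 1 else 0) else 1
  have hind0 (v j x) : 0 ≤ ind v j x := by
    simp only [ind]; split_ifs <;> norm_num
  have hle (f₂) : (if ExtendsFrom A ((s, comb f₂) : RDOmega n d m k) then (1 : ℝ) else 0) ≤
      ∑ v : B → Fin d, ∏ j, ind v j (f₂ j) := by
    split_ifs with hE
    swap
    · exact sum_nonneg fun v _ => prod_nonneg fun j _ => hind0 _ _ _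
    obtain ⟨c', hc'A, hc'⟩ := hE.2 c fun j hj => by
      have := hc ⟨j, hj⟩
      change comb f₂ j (R c j) = true
      simpa [comb, hj] using this
    refine le_trans (le_of_eq ?_) (single_le_sum
      (f := fun v : B → Fin d => ∏ j, ind v j (f₂ j))
      (fun v _ => prod_nonneg fun j _ => hind0 _ _ _) (mem_univ fun w : B => c' w))
    refine (prod_eq_one fun j _ => ?_).symm
    simp only [ind]
    split_ifs with h1 h2
    · rfl
    · refine absurd ?_ h2
      obtain ⟨u, huB, -, hS⟩ := h1
      have h3 : rdCompat ((s, comb f₂) : RDOmega n d m k) j.1 (ext fun w : B => c' w) := by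
        refine (rdCompat_congr fun w hw => ?_).2 (hc' j.1)
        by_cases hwB : w ∈ B
        · simp [ext, hwB]
        · simp only [ext, hwB, dif_neg, not_false_eq_true]
          rcases mem_insert.1 (hS hw) with rfl | hwA
          · exact absurd huB hwB
          · exact (hc'A w hwA).symm
      have h4 : comb f₂ j.1 (R (ext fun w : B => c' w) j.1) = true := h3
      simpa [comb, j.2] using h4
    · rfl
  have hW0 (f₂ : {j // ¬ (s j).1 ⊆ A} → (Fin n → Option (Fin d)) → Bool) :
      0 ≤ ∏ j, flagWeight p (f₂ j) := prod_nonneg fun _ _ => flagWeight_nonneg hp0 hp1 _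
  calc _ ≤ ∑ f₂ : {j // ¬ (s j).1 ⊆ A} → (Fin n → Option (Fin d)) → Bool,
        (∏ j, flagWeight p (f₂ j)) * ∑ v : B → Fin d, ∏ j, ind v j (f₂ j) :=
        sum_le_sum fun f₂ _ => mul_le_mul_of_nonneg_left (hle f₂) (hW0 f₂)
    _ = ∑ v : B → Fin d, ∏ j : {j // ¬ (s j).1 ⊆ A},
          (if Attached A B (s j).1 then 1 - p else 1) := by
        simp_rw [mul_sum]
        rw [sum_comm]
        refine sum_congr rfl fun v _ => ?_
        simp_rw [← prod_mul_distrib]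
        rw [← Fintype.prod_sum (fun (j : {j // ¬ (s j).1 ⊆ A})
          (x : (Fin n → Option (Fin d)) → Bool) => flagWeight p x * ind v j x)]
        refine prod_congr rfl fun j _ => ?_
        simp only [ind]
        split_ifs with h
        · exact sum_flagWeight_true _
        · simpa using sum_flagWeight
    _ = (d : ℝ) ^ B.card * ∏ j : {j // ¬ (s j).1 ⊆ A},
          (if Attached A B (s j).1 then 1 - p else 1) := by
        simp
    _ = (d : ℝ) ^ B.card * ∏ j, (if Attached A B (s j).1 then 1 - p else 1) := by
        congr 1
        rw [← Fintype.prod_subtype_mul_prod_subtype (fun j => (s j).1 ⊆ A)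
          (fun j => if Attached A B (s j).1 then 1 - p else 1)]
        rw [prod_eq_one (s := (univ : Finset {j // (s j).1 ⊆ A})), one_mul]
        intro j _
        rw [if_neg]
        rintro ⟨u, huB, huS, -⟩
        exact disjoint_left.1 hAB (j.2 huS) huB

end Flags

section Scopes

variable {n k : ℕ}

lemma ite_lt_one_le_rpow {x θ : ℝ} (hx : 0 ≤ x) (hθ0 : 0 ≤ θ) (hθ1 : θ ≤ 1) :
    (if x < 1 then x else 1) ≤ x ^ θ := by
  split_ifs with h
  · exact Real.self_le_rpow_of_le_one hx h.le hθ1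
  · exact Real.one_le_rpow (not_lt.1 h) hθ0

open Classical in
lemma ite_attached_eq_prod {A B S : Finset (Fin n)} (hAB : Disjoint A B) (y : ℝ) :
    (if Attached A B S then y else 1) =
      ∏ u ∈ B, if u ∈ S ∧ S ⊆ insert u A then y else 1 := by
  split_ifs with h
  · obtain ⟨u, huB, huS, hS⟩ := h
    rw [prod_eq_single_of_mem u huB, if_pos ⟨huS, hS⟩]
    intro u' hu' hne
    rw [if_neg]
    rintro ⟨hu'S, -⟩
    rcases mem_insert.1 (hS hu'S) with h | h
    · exact hne h
    · exact disjoint_left.1 hAB h hu'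
  · refine (prod_eq_one fun u hu => ?_).symm
    rw [if_neg]
    exact fun h' => h ⟨u, hu, h'⟩

open Classical in
lemma exists_subset_pow_mul_prod_le {ι : Type*} [Fintype ι] {A B : Finset (Fin n)}
    (hAB : Disjoint A B) (s : ι → Finset (Fin n)) {d q θ : ℝ} (hd : 0 ≤ d) (hq : 0 ≤ q)
    (hθ0 : 0 ≤ θ) (hθ1 : θ ≤ 1) :
    ∃ B' ⊆ B, d ^ B'.card * ∏ j, (if Attached A B' (s j) then q else 1) ≤
      (d ^ θ) ^ B.card * ∏ j, (if Attached A B (s j) then q ^ θ else 1) := by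
  let x (u : Fin n) : ℝ := d * ∏ j, if u ∈ s j ∧ s j ⊆ insert u A then q else 1
  have hite (u : Fin n) (j : ι) : 0 ≤ if u ∈ s j ∧ s j ⊆ insert u A then q else 1 := by
    split_ifs <;> [exact hq; exact zero_le_one]
  have hx (u : Fin n) : 0 ≤ x u := mul_nonneg hd (prod_nonneg fun j _ => hite u j)
  have hxθ (u : Fin n) :
      x u ^ θ = d ^ θ * ∏ j, if u ∈ s j ∧ s j ⊆ insert u A then q ^ θ else 1 := by
    rw [Real.mul_rpow hd (prod_nonneg fun j _ => hite u j),
      ← Real.finsetProd_rpow _ _ fun j _ => hite u j]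
    congr 1
    refine prod_congr rfl fun j _ => ?_
    split_ifs <;> simp
  refine ⟨B.filter fun u => x u < 1, filter_subset _ _, ?_⟩
  have hAB' : Disjoint A (B.filter fun u => x u < 1) := hAB.mono_right (filter_subset _ _)
  calc _ = ∏ u ∈ B with x u < 1, x u := by
        simp_rw [ite_attached_eq_prod hAB']
        rw [prod_comm, prod_mul_distrib, prod_const]
    _ = ∏ u ∈ B, if x u < 1 then x u else 1 := prod_filter _ _
    _ ≤ ∏ u ∈ B, x u ^ θ := by
        refine prod_le_prod (fun u _ => ?_) fun u _ => ite_lt_one_le_rpow (hx u) hθ0 hθ1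
        split_ifs <;> [exact hx u; exact zero_le_one]
    _ = _ := by
        simp_rw [ite_attached_eq_prod hAB, hxθ]
        rw [prod_comm (s := univ), prod_mul_distrib, prod_const]

open Classical in
lemma card_mul_choose_le_card_attached (hk : 1 ≤ k) {A B : Finset (Fin n)} (hAB : Disjoint A B) :
    B.card * A.card.choose (k - 1) ≤
      (univ.filter fun S : {S : Finset (Fin n) // S.card = k} => Attached A B S.1).card := by
  have h : B.card * A.card.choose (k - 1) =
      (B ×ˢ powersetCard (k - 1) A).card := by
    rw [card_product, card_powersetCard]
  have hnot {u : Fin n} {T : Finset (Fin n)} (hu : u ∈ B) (hT : T ⊆ A) : u ∉ T :=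
    fun h => disjoint_left.1 hAB (hT h) hu
  rw [h, ← card_map (Function.Embedding.subtype _)]
  refine card_le_card_of_injOn (fun x => insert x.1 x.2) ?_ ?_
  · rintro ⟨u, T⟩ hx
    obtain ⟨hu, hT⟩ : u ∈ B ∧ T ∈ powersetCard (k - 1) A :=
      mem_product.1 (mem_coe.1 hx)
    obtain ⟨hTA, hTk⟩ := mem_powersetCard.1 hT
    have hcard : (insert u T).card = k := by
      rw [card_insert_of_notMem (hnot hu hTA)]
      omega
    exact mem_coe.2 (mem_map.2 ⟨⟨insert u T, hcard⟩, mem_filter.2 ⟨mem_univ _, u, hu,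
      mem_insert_self _ _, insert_subset_insert _ hTA⟩, rfl⟩)
  · rintro ⟨u, T⟩ hx ⟨u', T'⟩ hx' heq
    obtain ⟨hu, hT⟩ : u ∈ B ∧ T ∈ powersetCard (k - 1) A :=
      mem_product.1 (mem_coe.1 hx)
    obtain ⟨hu', hT'⟩ : u' ∈ B ∧ T' ∈ powersetCard (k - 1) A :=
      mem_product.1 (mem_coe.1 hx')
    have hTA := (mem_powersetCard.1 hT).1
    have hTA' := (mem_powersetCard.1 hT').1
    have heq : insert u T = insert u' T' := heq
    have huu' : u = u' := by
      have h1 : u ∈ insert u' T' := heq ▸ mem_insert_self u T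
      exact (mem_insert.1 h1).resolve_right (hnot hu hTA')
    subst huu'
    have hTT' : T = T' := by
      rw [← erase_insert (hnot hu hTA), heq, erase_insert (hnot hu hTA')]
    rw [hTT']

open Classical in
lemma sum_scopes_le (hk : 1 ≤ k) (hkn : k ≤ n) {A B : Finset (Fin n)} (hAB : Disjoint A B) {y : ℝ}
    (hy : y ≤ 1) :
    (Fintype.card {S : Finset (Fin n) // S.card = k} : ℝ)⁻¹ *
        ∑ S : {S : Finset (Fin n) // S.card = k}, (if Attached A B S.1 then y else 1) ≤
      Real.exp (-((1 - y) * (B.card * A.card.choose (k - 1) / n.choose k))) := by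
  have hcard : Fintype.card {S : Finset (Fin n) // S.card = k} = n.choose k := by
    rw [Fintype.card_finset_len, Fintype.card_fin]
  have hpos : (0 : ℝ) < n.choose k := by exact_mod_cast Nat.choose_pos hkn
  have hsum : ∑ S : {S : Finset (Fin n) // S.card = k}, (if Attached A B S.1 then y else 1) =
      n.choose k - (1 - y) *
      (univ.filter fun S : {S : Finset (Fin n) // S.card = k} => Attached A B S.1).card := by
    have (S : {S : Finset (Fin n) // S.card = k}) : (if Attached A B S.1 then y else 1) =
        1 - (1 - y) * if Attached A B S.1 then 1 else 0 := by
      split_ifs <;> ring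
    simp_rw [this]
    rw [sum_sub_distrib, ← mul_sum, sum_boole, sum_const, card_univ, hcard]
    simp
  have hN : ((B.card * A.card.choose (k - 1) : ℕ) : ℝ) ≤
      ((univ.filter fun S : {S : Finset (Fin n) // S.card = k} => Attached A B S.1).card : ℝ) := by
    exact_mod_cast card_mul_choose_le_card_attached hk hAB
  push_cast at hN
  rw [hsum, hcard]
  refine le_trans ?_ (Real.one_sub_le_exp_neg _)
  rw [inv_mul_eq_div, div_le_iff₀ hpos, sub_mul _ _ (n.choose k : ℝ), mul_assoc (1 - y),
    div_mul_cancel₀ _ hpos.ne', one_mul]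
  exact sub_le_sub_left (mul_le_mul_of_nonneg_left hN (by linarith)) _

end Scopes

section UnionBound

variable {p : ℝ}

open Classical in
lemma rdPr_eq_sum {n d m k : ℕ} (E : RDOmega n d m k → Prop) :
    rdPr p n d m k E = ∑ s : Fin m → {S : Finset (Fin n) // S.card = k},
      ((Fintype.card {S : Finset (Fin n) // S.card = k} : ℝ))⁻¹ ^ m *
        ∑ f : Fin m → (Fin n → Option (Fin d)) → Bool,
          (∏ j, flagWeight p (f j)) * (if E (s, f) then 1 else 0) := by
  unfold rdPr
  rw [sum_filter, Fintype.sum_prod_type]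
  refine sum_congr rfl fun s _ => ?_
  rw [mul_sum]
  refine sum_congr rfl fun f _ => ?_
  simp only [rdWeight, flagWeight]
  split_ifs <;> simp

lemma rdPr_nonneg (hp0 : 0 ≤ p) (hp1 : p ≤ 1) {n d m k : ℕ} (E : RDOmega n d m k → Prop) :
    0 ≤ rdPr p n d m k E := by
  classical
  rw [rdPr_eq_sum]
  refine sum_nonneg fun s _ => mul_nonneg (by positivity) (sum_nonneg fun f _ =>
    mul_nonneg (prod_nonneg fun j _ => flagWeight_nonneg hp0 hp1 _) ?_)
  split_ifs <;> norm_num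

lemma rdPr_le_sum (hp0 : 0 ≤ p) (hp1 : p ≤ 1) {n d m k : ℕ} {ι : Type*} (t : Finset ι)
    {E : RDOmega n d m k → Prop} {F : ι → RDOmega n d m k → Prop}
    (h : ∀ ω, E ω → ∃ a ∈ t, F a ω) :
    rdPr p n d m k E ≤ ∑ a ∈ t, rdPr p n d m k (F a) := by
  classical
  have hw (ω : RDOmega n d m k) : 0 ≤ rdWeight p ω := by
    refine mul_nonneg (by positivity) (prod_nonneg fun i _ => prod_nonneg fun g _ => ?_)
    split_ifs <;> linarith
  unfold rdPr
  simp_rw [sum_filter]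
  rw [sum_comm]
  refine sum_le_sum fun ω _ => ?_
  have h0 (a : ι) : 0 ≤ if F a ω then rdWeight p ω else 0 := by
    split_ifs <;> [exact hw ω; exact le_rfl]
  split_ifs with hE
  · obtain ⟨a, ha, hF⟩ := h ω hE
    exact le_trans (by rw [if_pos hF])
      (single_le_sum (f := fun a => if F a ω then rdWeight p ω else 0) (fun a _ => h0 a) ha)
  · exact sum_nonneg fun a _ => h0 a

lemma rdPr_extendsFrom_le (hp0 : 0 ≤ p) (hp1 : p ≤ 1) {n d m k : ℕ} (hk : 1 ≤ k) (hkn : k ≤ n)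
    {A B : Finset (Fin n)} (hAB : Disjoint A B) {θ : ℝ} (hθ0 : 0 ≤ θ) (hθ1 : θ ≤ 1) :
    rdPr p n d m k (ExtendsFrom A) ≤ ((d : ℝ) ^ θ) ^ B.card *
      Real.exp (-((1 - (1 - p) ^ θ) * (B.card * A.card.choose (k - 1) / n.choose k))) ^ m := by
  classical
  have hq : 0 ≤ 1 - p := by linarith
  have hq1 : 1 - p ≤ 1 := by linarith
  rw [rdPr_eq_sum]
  set K : ℝ := (Fintype.card {S : Finset (Fin n) // S.card = k} : ℝ)⁻¹ with hK
  have hK0 : 0 ≤ K := by positivity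
  have hbound (s : Fin m → {S : Finset (Fin n) // S.card = k}) :
      ∑ f : Fin m → (Fin n → Option (Fin d)) → Bool, (∏ j, flagWeight p (f j)) *
        (if ExtendsFrom A ((s, f) : RDOmega n d m k) then 1 else 0) ≤
      ((d : ℝ) ^ θ) ^ B.card * ∏ j, (if Attached A B (s j).1 then (1 - p) ^ θ else 1) := by
    obtain ⟨B', hB', hle⟩ := exists_subset_pow_mul_prod_le hAB (fun j => (s j).1)
      (Nat.cast_nonneg d) hq hθ0 hθ1
    exact (sum_flags_extendsFrom_le hp0 hp1 (hAB.mono_right hB') s).trans hle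
  calc _ ≤ ∑ s : Fin m → {S : Finset (Fin n) // S.card = k}, K ^ m * (((d : ℝ) ^ θ) ^ B.card *
        ∏ j, (if Attached A B (s j).1 then (1 - p) ^ θ else 1)) :=
        sum_le_sum fun s _ => mul_le_mul_of_nonneg_left (hbound s) (by positivity)
    _ = ((d : ℝ) ^ θ) ^ B.card * (K * ∑ S : {S : Finset (Fin n) // S.card = k},
          (if Attached A B S.1 then (1 - p) ^ θ else 1)) ^ m := by
        rw [mul_pow, Fintype.sum_pow, ← mul_sum, ← mul_sum]
        ring
    _ ≤ _ := by
        refine mul_le_mul_of_nonneg_left (pow_le_pow_left₀ (mul_nonneg hK0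
          (sum_nonneg fun S _ => ?_)) (sum_scopes_le hk hkn hAB
            (Real.rpow_le_one hq hq1 hθ0)) m) (by positivity)
        split_ifs
        · exact Real.rpow_nonneg hq θ
        · exact zero_le_one

lemma rdPr_backtrackFree_le (hp0 : 0 ≤ p) (hp1 : p ≤ 1) {n d m k : ℕ} (hk : 1 ≤ k) (hkn : k ≤ n)
    (hd : 0 < d) {L : ℕ} (hL : L ≤ n) {θ : ℝ} (hθ0 : 0 ≤ θ) (hθ1 : θ ≤ 1) :
    rdPr p n d m k rdBacktrackFree ≤ 2 ^ n * (((d : ℝ) ^ θ) ^ L *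
      Real.exp (-((1 - (1 - p) ^ θ) * (L * (n - L).choose (k - 1) / n.choose k))) ^ m) := by
  calc _ ≤ ∑ A ∈ powersetCard (n - L) (univ : Finset (Fin n)),
        rdPr p n d m k (ExtendsFrom A) := by
        refine rdPr_le_sum hp0 hp1 _ fun ω hω => ?_
        obtain ⟨A, hA, h⟩ := exists_extendsFrom_of_backtrackFree hω hk hd (Nat.sub_le n L)
        exact ⟨A, mem_powersetCard.2 ⟨subset_univ _, hA⟩, h⟩
    _ ≤ ∑ A ∈ powersetCard (n - L) (univ : Finset (Fin n)), (((d : ℝ) ^ θ) ^ L *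
          Real.exp (-((1 - (1 - p) ^ θ) * (L * (n - L).choose (k - 1) / n.choose k))) ^ m) := by
        refine sum_le_sum fun A hA => ?_
        have hA := (mem_powersetCard.1 hA).2
        have hB : Aᶜ.card = L := by
          rw [card_compl, Fintype.card_fin, hA]
          omega
        have := rdPr_extendsFrom_le (d := d) (m := m) hp0 hp1 hk hkn
          (disjoint_compl_right (a := A)) hθ0 hθ1
        rwa [hA, hB] at this
    _ ≤ _ := by
        rw [sum_const, card_powersetCard, card_univ, Fintype.card_fin, nsmul_eq_mul]
        refine mul_le_mul_of_nonneg_right ?_ (by positivity)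
        exact_mod_cast Nat.choose_le_two_pow n (n - L)

end UnionBound

section Asymptotics

lemma mul_pow_le_choose_div_choose {n L k : ℕ} (hk : 1 ≤ k) (hkn : k ≤ n) {ρ : ℝ}
    (hρ0 : 0 ≤ ρ) (hρ : ρ * n ≤ n - L - k) :
    k * L * ρ ^ (k - 1) / n ≤ L * (n - L).choose (k - 1) / n.choose k := by
  obtain ⟨k, rfl⟩ := Nat.exists_eq_add_of_le' hk
  obtain ⟨n, rfl⟩ := Nat.exists_eq_add_of_le' (hk.trans hkn)
  have hkn' : k ≤ n := by omega
  rw [Nat.add_sub_cancel]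
  have hC : (0 : ℝ) < n.choose k := by exact_mod_cast Nat.choose_pos hkn'
  have hC' : (0 : ℝ) < (n + 1).choose (k + 1) := by exact_mod_cast Nat.choose_pos hkn
  have hmul : ((n : ℝ) + 1) * n.choose k = (n + 1).choose (k + 1) * (k + 1) := by
    exact_mod_cast Nat.add_one_mul_choose_eq n k
  have hfac : (0 : ℝ) < k.factorial := by exact_mod_cast k.factorial_pos
  have hratio : ρ ^ k * n.choose k ≤ (n + 1 - L).choose k := by
    refine le_of_mul_le_mul_left ?_ hfac
    have hbase : ρ * n ≤ ((n + 1 - L + 1 - k : ℕ) : ℝ) := by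
      have h1 : n + 1 ≤ (n + 1 - L + 1 - k) + L + k := by omega
      have h2 : ((n : ℝ) + 1) ≤ ((n + 1 - L + 1 - k : ℕ) : ℝ) + L + k := by exact_mod_cast h1
      push_cast at hρ
      nlinarith
    calc (k.factorial : ℝ) * (ρ ^ k * n.choose k) = ρ ^ k * (n.descFactorial k : ℕ) := by
          rw [Nat.descFactorial_eq_factorial_mul_choose]; push_cast; ring
      _ ≤ ρ ^ k * (n : ℝ) ^ k := by
          refine mul_le_mul_of_nonneg_left ?_ (by positivity)
          exact_mod_cast Nat.descFactorial_le_pow n k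
      _ = (ρ * n) ^ k := (mul_pow _ _ _).symm
      _ ≤ ((n + 1 - L + 1 - k : ℕ) : ℝ) ^ k := pow_le_pow_left₀ (by positivity) hbase k
      _ ≤ ((n + 1 - L).descFactorial k : ℕ) := by
          exact_mod_cast Nat.pow_sub_le_descFactorial (n + 1 - L) k
      _ = k.factorial * ((n + 1 - L).choose k : ℝ) := by
          rw [Nat.descFactorial_eq_factorial_mul_choose]; push_cast; ring
  rw [div_le_div_iff₀ (by positivity) hC']
  push_cast
  calc ((k : ℝ) + 1) * L * ρ ^ k * (n + 1).choose (k + 1)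
      = L * (ρ ^ k * n.choose k) * (n + 1) := by linear_combination (-(L * ρ ^ k)) * hmul
    _ ≤ _ := by gcongr

open Filter Topology in
/-- A strict inequality `a < b` survives a small perturbation of `b`. -/
lemma exists_perturbation {a b : ℝ} (hab : a < b) (l : ℝ) (j : ℕ) :
    ∃ t : ℝ, 0 < t ∧ t < 1 / 2 ∧ 0 < 1 + t * l ∧ a < b / (1 + t * l) * (1 - 2 * t) ^ j := by
  have hcont : ContinuousAt (fun t : ℝ => b / (1 + t * l) * (1 - 2 * t) ^ j) 0 := by
    refine ContinuousAt.mul (ContinuousAt.div ?_ ?_ (by simp)) ?_ <;> fun_prop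
  have h1 : ∀ᶠ t in 𝓝[>] (0 : ℝ), a < b / (1 + t * l) * (1 - 2 * t) ^ j :=
    (hcont.eventually_const_lt (by simpa using hab)).filter_mono nhdsWithin_le_nhds
  have h2 : ∀ᶠ t in 𝓝[>] (0 : ℝ), 0 < 1 + t * l :=
    ((by fun_prop : ContinuousAt (fun t : ℝ => 1 + t * l) 0).eventually_const_lt
      (by simp)).filter_mono nhdsWithin_le_nhds
  have h3 : ∀ᶠ t in 𝓝[>] (0 : ℝ), t < 1 / 2 :=
    (eventually_lt_nhds (by norm_num)).filter_mono nhdsWithin_le_nhds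
  obtain ⟨t, ht1, ht2, ht3, ht0⟩ := (h1.and (h2.and (h3.and self_mem_nhdsWithin))).exists
  exact ⟨t, ht0, ht3, ht2, ht1⟩

lemma div_one_add_le_one_sub_rpow {q t : ℝ} (hq : 0 < q) (ht : 0 < 1 + t * -Real.log q) :
    t * -Real.log q / (1 + t * -Real.log q) ≤ 1 - q ^ t := by
  have h1 : q ^ t = Real.exp (-(t * -Real.log q)) := by
    rw [Real.rpow_def_of_pos hq]; ring_nf
  have h2 : Real.exp (-(t * -Real.log q)) ≤ (1 + t * -Real.log q)⁻¹ := by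
    rw [Real.exp_neg]
    exact inv_anti₀ ht (by linarith [Real.add_one_le_exp (t * -Real.log q)])
  rw [h1]
  have h3 : t * -Real.log q / (1 + t * -Real.log q) = 1 - (1 + t * -Real.log q)⁻¹ := by
    rw [eq_sub_iff_add_eq, div_eq_mul_inv, ← add_one_mul, add_comm _ (1 : ℝ),
      mul_inv_cancel₀ ht.ne']
  rw [h3]
  linarith

end Asymptotics

set_option maxHeartbeats 1000000 in
open Filter Topology in
lemma eventually_rdPr_backtrackFree_le {α p r : ℝ} {k : ℕ} (hα : 0 < α) (hp0 : 0 < p)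
    (hp1 : p < 1) (hk : 2 ≤ k) (hr0 : 0 < r) (hr : -α / (k * Real.log (1 - p)) < r) :
    ∀ᶠ n : ℕ in atTop, rdPr p n ⌈(n : ℝ) ^ α⌉₊ ⌈r * n * Real.log n⌉₊ k rdBacktrackFree ≤
      Real.exp (-(n : ℝ)) := by
  have hq : 0 < 1 - p := by linarith
  set l : ℝ := -Real.log (1 - p) with hl
  have hl0 : 0 < l := by
    have := Real.log_neg hq (by linarith)
    linarith
  have hk0 : (0 : ℝ) < k := by exact_mod_cast (by omega : 0 < k)
  have hgap : α < r * k * l := by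
    have h1 : -α / (k * Real.log (1 - p)) = α / (k * l) := by
      rw [hl, mul_neg, div_neg, neg_div]
    rw [h1, div_lt_iff₀ (by positivity)] at hr
    linarith
  obtain ⟨t, ht0, ht1, htl, hG⟩ := exists_perturbation hgap l (k - 1)
  set G : ℝ := r * k * l / (1 + t * l) * (1 - 2 * t) ^ (k - 1) with hGdef
  have hlog : Tendsto (fun n : ℕ => Real.log (n : ℝ)) atTop atTop :=
    Real.tendsto_log_atTop.comp tendsto_natCast_atTop_atTop
  filter_upwards [eventually_ge_atTop k, tendsto_natCast_atTop_atTop.eventually_ge_atTop (2 / t),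
    tendsto_natCast_atTop_atTop.eventually_ge_atTop (k / t),
    hlog.eventually_ge_atTop ((Real.log 2 + 4 / (t * t)) / (G - α))] with n hkn hn2 hnk hnlog
  have hn1 : (1 : ℝ) ≤ n := by exact_mod_cast (by omega : 1 ≤ n)
  have hn0 : (0 : ℝ) < n := by linarith
  have hlogn : 0 ≤ Real.log n := Real.log_nonneg hn1
  rw [div_le_iff₀ ht0] at hn2 hnk
  rw [div_le_iff₀ (by linarith)] at hnlog
  set L : ℕ := ⌊t * n⌋₊ with hL
  have hLle : (L : ℝ) ≤ t * n := Nat.floor_le (by positivity)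
  have hLge : t * n / 2 ≤ L := by
    have := Nat.lt_floor_add_one (t * n)
    linarith
  have hLn : L ≤ n := by
    have : (L : ℝ) ≤ n := by nlinarith
    exact_mod_cast this
  have hna : (1 : ℝ) ≤ (n : ℝ) ^ α := Real.one_le_rpow hn1 hα.le
  set d : ℕ := ⌈(n : ℝ) ^ α⌉₊ with hd
  have hd0 : 0 < d := Nat.ceil_pos.2 (by linarith)
  have hd0' : (0 : ℝ) < d := by exact_mod_cast hd0
  have hlogd : Real.log d ≤ Real.log 2 + α * Real.log n := by
    have h1 : (d : ℝ) ≤ 2 * (n : ℝ) ^ α := by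
      have := Nat.ceil_lt_add_one (a := (n : ℝ) ^ α) (by linarith)
      linarith
    calc Real.log d ≤ Real.log (2 * (n : ℝ) ^ α) := Real.log_le_log hd0' h1
      _ = _ := by rw [Real.log_mul (by norm_num) (by positivity), Real.log_rpow hn0]
  set m : ℕ := ⌈r * n * Real.log n⌉₊ with hm
  have hmge : r * n * Real.log n ≤ m := Nat.le_ceil _
  refine (rdPr_backtrackFree_le hp0.le hp1.le (by omega) hkn hd0 hLn ht0.le
    (by linarith)).trans ?_
  have hρ : (1 - 2 * t) * n ≤ n - L - k := by linarith
  have hQ := mul_pow_le_choose_div_choose (L := L) (by omega) hkn (by linarith) hρ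
  have hY := div_one_add_le_one_sub_rpow hq htl
  rw [← hl] at hY
  set Q : ℝ := L * (n - L).choose (k - 1) / n.choose k
  set Y : ℝ := 1 - (1 - p) ^ t
  have hρ0 : 0 ≤ 1 - 2 * t := by linarith
  have hexp : t * L * G * Real.log n ≤ m * (Y * Q) := by
    calc t * L * G * Real.log n
        = (r * n * Real.log n) *
          (t * l / (1 + t * l) * (k * L * (1 - 2 * t) ^ (k - 1) / n)) := by
          rw [hGdef]; field_simp
      _ ≤ m * (Y * Q) := by
          have : 0 ≤ t * l / (1 + t * l) := by positivity
          have : 0 ≤ k * L * (1 - 2 * t) ^ (k - 1) / n := by positivity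
          gcongr
          linarith
  have hD : ((d : ℝ) ^ t) ^ L = Real.exp (L * (t * Real.log d)) := by
    rw [Real.rpow_def_of_pos hd0', ← Real.exp_nat_mul, mul_comm (Real.log d)]
  have h2 : (2 : ℝ) ^ n = Real.exp (n * Real.log 2) := by
    rw [Real.exp_nat_mul, Real.exp_log (by norm_num)]
  rw [hD, h2, ← Real.exp_nat_mul, ← Real.exp_add, ← Real.exp_add, Real.exp_le_exp]
  have hlog2 : Real.log 2 ≤ 1 := by linarith [Real.log_two_lt_d9]
  have htL : 0 ≤ t * L := by positivity
  have hdec : t * L * Real.log d - t * L * G * Real.log n ≤ t * L * (-(4 / (t * t))) := by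
    have : Real.log d - G * Real.log n ≤ -(4 / (t * t)) := by linarith
    nlinarith
  have hfin : t * L * (-(4 / (t * t))) ≤ -(2 * n) := by
    have h : 2 * n ≤ 4 / t * L := by
      rw [div_mul_eq_mul_div, le_div_iff₀ ht0]
      linarith
    have h' : t * L * (-(4 / (t * t))) = -(4 / t * L) := by field_simp
    linarith
  nlinarith

end ModelRD

/-- Let `α > 0`, `p ∈ (0,1)`, `k ≥ 2` and `r_bf = -α/(k ln(1-p))`. If `r > r_bf`,
then the probability that a random instance of Model RD (with domain size `d = ⌈n^α⌉` and
`m = ⌈r n ln n⌉` constraints) is backtrack-free tends to `0` as `n → ∞`. -/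
theorem rd_backtrackFree_above (α p r : ℝ) (k : ℕ) (hα : 0 < α) (hp0 : 0 < p) (hp1 : p < 1)
    (hk : 2 ≤ k) (hr0 : 0 < r) (hr : -α / (k * Real.log (1 - p)) < r) :
    Filter.Tendsto
      (fun n : ℕ => rdPr p n ⌈(n : ℝ) ^ α⌉₊ ⌈r * n * Real.log n⌉₊ k rdBacktrackFree)
      Filter.atTop (nhds 0) := by
  exact squeeze_zero' (Filter.Eventually.of_forall fun n => ModelRD.rdPr_nonneg hp0.le hp1.le _)
    (ModelRD.eventually_rdPr_backtrackFree_le hα hp0 hp1 hk hr0 hr)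
    (Real.tendsto_exp_neg_atTop_nhds_zero.comp tendsto_natCast_atTop_atTop)
end

section
/- Let p ∈ (0,1) and the integer k ≥ 2 be constants with k ≥ 1/(1−p), let α > 1/k be constant, and let r_cr = −α/ln(1−p). Then the probability that a random instance of Model RD is satisfiable (admits an assignment of domain values to all variables compatible with every constraint) tends, as n → ∞, to 1 if r < r_cr and to 0 if r > r_cr. -/
section Probability

theorem rdPr_eq_sum_ite (p : ℝ) (n d m k : ℕ) (E : RDOmega n d m k → Prop) [DecidablePred E] :
    rdPr p n d m k E = ∑ ω, if E ω then rdWeight p ω else 0 := by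
  unfold rdPr
  rw [Finset.sum_filter]
  refine Finset.sum_congr rfl fun ω _ => ?_
  congr

theorem rdWeight_nonneg {p : ℝ} (hp0 : 0 ≤ p) (hp1 : p ≤ 1) {n d m k : ℕ}
    (ω : RDOmega n d m k) : 0 ≤ rdWeight p ω := by
  refine mul_nonneg (by positivity) (Finset.prod_nonneg fun i _ => Finset.prod_nonneg fun g _ => ?_)
  split_ifs <;> linarith

theorem rdPr_mono {p : ℝ} (hp0 : 0 ≤ p) (hp1 : p ≤ 1) {n d m k : ℕ}
    {E F : RDOmega n d m k → Prop} (h : ∀ ω, E ω → F ω) :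
    rdPr p n d m k E ≤ rdPr p n d m k F := by
  classical
  rw [rdPr_eq_sum_ite, rdPr_eq_sum_ite]
  refine Finset.sum_le_sum fun ω _ => ?_
  have := rdWeight_nonneg hp0 hp1 ω
  have := h ω
  split_ifs <;> tauto

/-- The flags of a single constraint: the probability that all flags in `T` are `true`. -/
theorem sum_flags_forall_mem {G : Type*} [Fintype G] [DecidableEq G] (p : ℝ) (T : Finset G) :
    ∑ b : G → Bool, (∏ g, if b g then 1 - p else p) * (if ∀ g ∈ T, b g = true then 1 else 0) =
      (1 - p) ^ T.card := by
  have h : ∀ b : G → Bool,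
      (∏ g, if b g then 1 - p else p) * (if ∀ g ∈ T, b g = true then 1 else 0) =
        ∏ g, ((if b g then 1 - p else p) * (if g ∈ T → b g = true then 1 else 0)) := by
    intro b
    rw [Finset.prod_mul_distrib, Finset.prod_ite_zero]
    simp
  simp_rw [h]
  have h2 := Finset.prod_univ_sum (fun _ : G => (Finset.univ : Finset Bool))
    (fun g x => (if x then 1 - p else p) * (if g ∈ T → x = true then (1 : ℝ) else 0))
  rw [Fintype.piFinset_univ] at h2
  rw [← h2]
  have h3 : ∀ g : G, (∑ x : Bool, (if x then 1 - p else p) *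
      (if g ∈ T → x = true then (1 : ℝ) else 0)) = if g ∈ T then 1 - p else 1 := by
    intro g
    by_cases hg : g ∈ T <;> simp [hg]
  simp_rw [h3]
  rw [Finset.prod_ite]
  simp

theorem sum_rdWeight_mul_prod (p : ℝ) {n d m k : ℕ}
    (F : {S : Finset (Fin n) // S.card = k} → ((Fin n → Option (Fin d)) → Bool) → ℝ) :
    ∑ ω : RDOmega n d m k, rdWeight p ω * ∏ i, F (ω.1 i) (ω.2 i) =
      ((Fintype.card {S : Finset (Fin n) // S.card = k} : ℝ)⁻¹ *
        ∑ S, ∑ b, (∏ g, if b g then 1 - p else p) * F S b) ^ m := by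
  rw [mul_pow, ← Fintype.sum_prod_type', Fintype.sum_pow, Finset.mul_sum]
  refine Fintype.sum_equiv
    (Equiv.arrowProdEquivProdArrow (Fin m) (fun _ => {S : Finset (Fin n) // S.card = k})
      (fun _ => (Fin n → Option (Fin d)) → Bool)).symm _ _ fun ω => ?_
  simp only [rdWeight, Finset.prod_mul_distrib, mul_assoc]
  rfl

/-- The restriction of an assignment to a scope. -/
def rdRestrict {n d : ℕ} (S : Finset (Fin n)) (c : Fin n → Fin d) : Fin n → Option (Fin d) :=
  fun v => if v ∈ S then some (c v) else none

theorem rdRestrict_eq_iff {n d : ℕ} (S : Finset (Fin n)) (a b : Fin n → Fin d) :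
    rdRestrict S a = rdRestrict S b ↔ S ⊆ Finset.univ.filter (fun v => a v = b v) := by
  simp only [funext_iff, rdRestrict, Finset.subset_iff, Finset.mem_filter, Finset.mem_univ,
    true_and]
  refine forall_congr' fun v => ?_
  by_cases hv : v ∈ S <;> simp [hv]

/-- The probability that all assignments in `A` are simultaneously solutions. -/
theorem rdPr_forall_mem_compat (p : ℝ) (n d m k : ℕ) (A : Finset (Fin n → Fin d)) :
    rdPr p n d m k (fun ω => ∀ a ∈ A, ∀ i, rdCompat ω i a) =
      ((Fintype.card {S : Finset (Fin n) // S.card = k} : ℝ)⁻¹ *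
        ∑ S : {S : Finset (Fin n) // S.card = k},
          (1 - p) ^ (A.image (rdRestrict S.1)).card) ^ m := by
  classical
  rw [rdPr_eq_sum_ite]
  simp_rw [← sum_flags_forall_mem]
  rw [← sum_rdWeight_mul_prod]
  refine Finset.sum_congr rfl fun ω _ => ?_
  rw [Finset.prod_ite_zero]
  have h : (∀ a ∈ A, ∀ i, rdCompat ω i a) ↔
      ∀ i ∈ (Finset.univ : Finset (Fin m)),
        ∀ g ∈ A.image (rdRestrict (ω.1 i).1), ω.2 i g = true := by
    simp only [Finset.mem_univ, true_imp_iff, Finset.forall_mem_image]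
    exact ⟨fun h i a ha => h a ha i, fun h a ha i => h i ha⟩
  by_cases h' : ∀ a ∈ A, ∀ i, rdCompat ω i a
  · rw [if_pos h', if_pos (h.1 h')]; simp
  · rw [if_neg h', if_neg (fun h2 => h' (h.2 h2))]; simp

theorem card_scopes (n k : ℕ) :
    Fintype.card {S : Finset (Fin n) // S.card = k} = n.choose k := by
  simp

theorem rdPr_le_one {p : ℝ} (hp0 : 0 ≤ p) (hp1 : p ≤ 1) {n d m k : ℕ} (hn : k ≤ n)
    (E : RDOmega n d m k → Prop) : rdPr p n d m k E ≤ 1 := by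
  refine (rdPr_mono (F := fun ω => ∀ a ∈ (∅ : Finset (Fin n → Fin d)), ∀ i, rdCompat ω i a)
    hp0 hp1 (by simp)).trans ?_
  rw [rdPr_forall_mem_compat]
  have := (Nat.choose_pos hn).ne'
  simp [this]

theorem rdPr_forall_compat (p : ℝ) {n d m k : ℕ} (hn : k ≤ n) (a : Fin n → Fin d) :
    rdPr p n d m k (fun ω => ∀ i, rdCompat ω i a) = (1 - p) ^ m := by
  have h := rdPr_forall_mem_compat p n d m k {a}
  have := (Nat.choose_pos hn).ne'
  simpa [this, ← mul_one_sub] using h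

theorem rdPr_forall_compat_pair {p : ℝ} (hp1 : p < 1) {n d m k : ℕ} (hn : k ≤ n)
    (a b : Fin n → Fin d) :
    rdPr p n d m k (fun ω => (∀ i, rdCompat ω i a) ∧ ∀ i, rdCompat ω i b) =
      ((1 - p) ^ m) ^ 2 * (1 + p / (1 - p) *
        ((Finset.univ.filter (fun v => a v = b v)).card.choose k / n.choose k)) ^ m := by
  have h := rdPr_forall_mem_compat p n d m k {a, b}
  have hC : (n.choose k : ℝ) ≠ 0 := by exact_mod_cast (Nat.choose_pos hn).ne'
  have hq : (1 - p) ≠ 0 := by linarith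
  simp only [Finset.mem_insert, Finset.mem_singleton, forall_eq_or_imp, forall_eq] at h
  rw [h, card_scopes, ← pow_mul, mul_comm m 2, pow_mul, ← mul_pow]
  congr 1
  set D := Finset.univ.filter (fun v => a v = b v) with hD
  have h1 : ∀ S : Finset (Fin n), (1 - p) ^ (Finset.image (rdRestrict S) {a, b}).card =
      (1 - p) ^ 2 + if S ⊆ D then (1 - p) * p else 0 := by
    intro S
    rw [Finset.image_insert, Finset.image_singleton]
    by_cases h : rdRestrict S a = rdRestrict S b
    · rw [if_pos ((rdRestrict_eq_iff S a b).1 h), h, Finset.pair_eq_singleton,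
        Finset.card_singleton]
      ring
    · rw [if_neg (fun h' => h ((rdRestrict_eq_iff S a b).2 h')), Finset.card_pair h]
      ring
  simp_rw [h1]
  rw [Finset.sum_add_distrib]
  have h2 : (∑ S : {S : Finset (Fin n) // S.card = k}, if S.1 ⊆ D then (1 - p) * p else 0) =
      D.card.choose k * ((1 - p) * p) := by
    rw [← Finset.sum_filter, Finset.sum_const, nsmul_eq_mul, ← Finset.card_powersetCard]
    congr 2
    refine Finset.card_bij (fun S _ => S.1) ?_ ?_ ?_
    · intro S hS
      exact Finset.mem_powersetCard.2 ⟨(Finset.mem_filter.1 hS).2, S.2⟩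
    · intro S _ T _ h
      exact Subtype.ext h
    · intro S hS
      obtain ⟨h1, h2⟩ := Finset.mem_powersetCard.1 hS
      exact ⟨⟨S, h2⟩, by simpa using h1, rfl⟩
  rw [h2, Finset.sum_const, Finset.card_univ, card_scopes, nsmul_eq_mul]
  field_simp

theorem rdPr_exists_le {p : ℝ} (hp0 : 0 ≤ p) (hp1 : p ≤ 1) {n d m k : ℕ} (hn : k ≤ n) :
    rdPr p n d m k (fun ω => ∃ a : Fin n → Fin d, ∀ j, rdCompat ω j a) ≤
      (d : ℝ) ^ n * (1 - p) ^ m := by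
  classical
  have h : (d : ℝ) ^ n * (1 - p) ^ m =
      ∑ a : Fin n → Fin d, rdPr p n d m k (fun ω => ∀ i, rdCompat ω i a) := by
    simp [rdPr_forall_compat p hn]
  rw [h]
  simp_rw [rdPr_eq_sum_ite]
  rw [Finset.sum_comm]
  refine Finset.sum_le_sum fun ω _ => ?_
  have hw := rdWeight_nonneg hp0 hp1 ω
  have hnn : ∀ a ∈ (Finset.univ : Finset (Fin n → Fin d)),
      0 ≤ if ∀ i, rdCompat ω i a then rdWeight p ω else 0 := by
    intro a _
    split_ifs <;> simp [hw]
  split_ifs with hE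
  · obtain ⟨a, ha⟩ := hE
    refine le_trans ?_ (Finset.single_le_sum hnn (Finset.mem_univ a))
    rw [if_pos ha]
  · exact Finset.sum_nonneg hnn

theorem card_filter_agree_eq {n d : ℕ} (a : Fin n → Fin d) (D : Finset (Fin n)) :
    (Finset.univ.filter fun b : Fin n → Fin d =>
      Finset.univ.filter (fun v => a v = b v) = D).card = (d - 1) ^ (n - D.card) := by
  have h : (Finset.univ.filter fun b : Fin n → Fin d =>
      Finset.univ.filter (fun v => a v = b v) = D) =
      Fintype.piFinset fun v => if v ∈ D then {a v} else Finset.univ.erase (a v) := by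
    ext b
    simp only [Finset.mem_filter, Finset.mem_univ, true_and, Fintype.mem_piFinset,
      Finset.ext_iff]
    refine forall_congr' fun v => ?_
    by_cases hv : v ∈ D <;> simp [hv, eq_comm]
  rw [h, Fintype.card_piFinset]
  have h2 : ∀ v, (if v ∈ D then {a v} else Finset.univ.erase (a v)).card =
      if v ∈ D then 1 else d - 1 := by
    intro v
    split_ifs <;> simp
  simp_rw [h2]
  rw [Finset.prod_ite]
  simp [Finset.filter_not, Finset.card_sdiff]

theorem sum_card_agree {n d : ℕ} (a : Fin n → Fin d) (f : ℕ → ℝ) :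
    ∑ b : Fin n → Fin d, f (Finset.univ.filter (fun v => a v = b v)).card =
      ∑ s ∈ Finset.range (n + 1), (n.choose s : ℝ) * (((d - 1 : ℕ) : ℝ) ^ (n - s) * f s) := by
  rw [← Finset.sum_fiberwise (s := Finset.univ)
    (g := fun b : Fin n → Fin d => Finset.univ.filter (fun v => a v = b v))]
  have h : ∀ D : Finset (Fin n), (∑ b ∈ Finset.univ.filter (fun b : Fin n → Fin d =>
      Finset.univ.filter (fun v => a v = b v) = D),
        f (Finset.univ.filter (fun v => a v = b v)).card) =
      ((d - 1 : ℕ) : ℝ) ^ (n - D.card) * f D.card := by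
    intro D
    rw [Finset.sum_congr rfl (g := fun _ => f D.card), Finset.sum_const, card_filter_agree_eq,
      nsmul_eq_mul]
    · push_cast; rfl
    · intro b hb
      rw [(Finset.mem_filter.1 hb).2]
  simp_rw [h]
  have := Finset.sum_powerset_apply_card (fun s => ((d - 1 : ℕ) : ℝ) ^ (n - s) * f s)
    (x := (Finset.univ : Finset (Fin n)))
  rw [Finset.powerset_univ] at this
  simpa using this

/-- The second moment of the number of solutions divided by the squared first moment. -/
noncomputable def rdRatio (c : ℝ) (n d m k : ℕ) : ℝ :=
  ∑ s ∈ Finset.range (n + 1), (n.choose s : ℝ) * ((((d - 1 : ℕ) : ℝ) ^ (n - s) / (d : ℝ) ^ n) *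
    (1 + c * (s.choose k / n.choose k)) ^ m)

theorem one_le_rdPr_exists_mul_rdRatio {p : ℝ} (hp0 : 0 ≤ p) (hp1 : p < 1) {n d m k : ℕ}
    (hn : k ≤ n) (hd : 0 < d) :
    1 ≤ rdPr p n d m k (fun ω => ∃ a : Fin n → Fin d, ∀ j, rdCompat ω j a) *
      rdRatio (p / (1 - p)) n d m k := by
  classical
  set N : RDOmega n d m k → ℝ := fun ω =>
    ∑ a : Fin n → Fin d, if ∀ i, rdCompat ω i a then 1 else 0 with hN
  have hdn : (0 : ℝ) < (d : ℝ) ^ n := by positivity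
  have hq : (0 : ℝ) < (1 - p) ^ m := pow_pos (by linarith) m
  have h1 : ∑ ω, rdWeight p ω * N ω = (d : ℝ) ^ n * (1 - p) ^ m := by
    have : (d : ℝ) ^ n * (1 - p) ^ m =
        ∑ a : Fin n → Fin d, rdPr p n d m k (fun ω => ∀ i, rdCompat ω i a) := by
      simp [rdPr_forall_compat p hn]
    rw [this]
    simp_rw [rdPr_eq_sum_ite, hN, Finset.mul_sum, mul_ite, mul_one, mul_zero]
    exact Finset.sum_comm
  have h2 : ∑ ω, rdWeight p ω * N ω ^ 2 =
      ((d : ℝ) ^ n * (1 - p) ^ m) ^ 2 * rdRatio (p / (1 - p)) n d m k := by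
    have h3 : ∑ ω, rdWeight p ω * N ω ^ 2 = ∑ a : Fin n → Fin d, ∑ b : Fin n → Fin d,
        rdPr p n d m k (fun ω => (∀ i, rdCompat ω i a) ∧ ∀ i, rdCompat ω i b) := by
      simp_rw [rdPr_eq_sum_ite]
      rw [Finset.sum_congr rfl fun (a : Fin n → Fin d) _ => Finset.sum_comm, Finset.sum_comm]
      refine Finset.sum_congr rfl fun ω _ => ?_
      rw [sq, hN, Finset.sum_mul_sum, Finset.mul_sum]
      refine Finset.sum_congr rfl fun a _ => ?_
      rw [Finset.mul_sum]
      refine Finset.sum_congr rfl fun b _ => ?_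
      by_cases ha : ∀ i, rdCompat ω i a <;> by_cases hb : ∀ i, rdCompat ω i b <;> simp [ha, hb]
    rw [h3]
    simp_rw [rdPr_forall_compat_pair hp1 hn]
    simp_rw [← Finset.mul_sum]
    simp_rw [sum_card_agree _ (fun s : ℕ =>
      (1 + p / (1 - p) * ((s.choose k : ℝ) / n.choose k)) ^ m)]
    rw [Finset.sum_const, rdRatio, Finset.card_univ, nsmul_eq_mul, Fintype.card_fun,
      Fintype.card_fin, Fintype.card_fin, Finset.mul_sum, Finset.mul_sum, Finset.mul_sum]
    refine Finset.sum_congr rfl fun s _ => ?_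
    push_cast
    field_simp
  have hcs : (∑ ω, rdWeight p ω * N ω) ^ 2 ≤
      rdPr p n d m k (fun ω => ∃ a : Fin n → Fin d, ∀ j, rdCompat ω j a) *
        ∑ ω, rdWeight p ω * N ω ^ 2 := by
    rw [rdPr_eq_sum_ite]
    refine Finset.sum_sq_le_sum_mul_sum_of_sq_le_mul _ ?_ ?_ ?_
    · intro ω _
      have := rdWeight_nonneg hp0 hp1.le ω
      split_ifs <;> simp [this]
    · intro ω _
      have := rdWeight_nonneg hp0 hp1.le ω
      positivity
    · intro ω _
      split_ifs with h
      · exact (by ring : _ = _).le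
      · have : N ω = 0 := by
          refine Finset.sum_eq_zero fun a _ => ?_
          rw [if_neg (fun h' => h ⟨a, h'⟩)]
        simp [this]
  rw [h1, h2] at hcs
  have hpos : 0 < ((d : ℝ) ^ n * (1 - p) ^ m) ^ 2 := by positivity
  nlinarith

end Probability

section Analysis

open Filter Topology

theorem Nat.descFactorial_mul_pow_le {s n : ℕ} (hs : s ≤ n) (k : ℕ) :
    s.descFactorial k * n ^ k ≤ n.descFactorial k * s ^ k := by
  induction k with
  | zero => simp
  | succ k ih =>
    have h : (s - k) * n ≤ (n - k) * s := by
      rw [Nat.sub_mul, Nat.sub_mul, mul_comm n s]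
      exact Nat.sub_le_sub_left (Nat.mul_le_mul_left k hs) _
    calc s.descFactorial (k + 1) * n ^ (k + 1)
        = ((s - k) * n) * (s.descFactorial k * n ^ k) := by
          rw [Nat.descFactorial_succ]; ring
      _ ≤ ((n - k) * s) * (n.descFactorial k * s ^ k) := Nat.mul_le_mul h ih
      _ = n.descFactorial (k + 1) * s ^ (k + 1) := by
          rw [Nat.descFactorial_succ]; ring

theorem choose_div_choose_le_pow {s n k : ℕ} (hs : s ≤ n) (hk : k ≤ n) (hn : 0 < n) :
    (s.choose k : ℝ) / n.choose k ≤ ((s : ℝ) / n) ^ k := by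
  have h1 : 0 < n.choose k := Nat.choose_pos hk
  rw [div_pow, div_le_div_iff₀ (by exact_mod_cast h1) (by positivity)]
  have h := Nat.descFactorial_mul_pow_le hs k
  rw [Nat.descFactorial_eq_factorial_mul_choose, Nat.descFactorial_eq_factorial_mul_choose,
    mul_assoc, mul_assoc] at h
  have h2 := Nat.le_of_mul_le_mul_left h (Nat.factorial_pos k)
  rw [mul_comm (n.choose k)] at h2
  exact_mod_cast h2

theorem choose_le_exp_mul_div_pow (n : ℕ) {s : ℕ} (hs : 0 < s) :
    (n.choose s : ℝ) ≤ (Real.exp 1 * n / s) ^ s := by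
  have hs' : (0 : ℝ) < s := by exact_mod_cast hs
  have h1 : (n.choose s : ℝ) ≤ (n : ℝ) ^ s / s.factorial := Nat.choose_le_pow_div s n
  have h2 := Real.pow_div_factorial_le_exp (s : ℝ) hs'.le s
  have h3 : Real.exp (s : ℝ) = Real.exp 1 ^ s := by
    rw [← Real.exp_nat_mul, mul_one]
  rw [h3] at h2
  calc (n.choose s : ℝ) ≤ (n : ℝ) ^ s / s.factorial := h1
    _ = (n : ℝ) ^ s / (s : ℝ) ^ s * ((s : ℝ) ^ s / s.factorial) := by
      field_simp
    _ ≤ (n : ℝ) ^ s / (s : ℝ) ^ s * Real.exp 1 ^ s := by gcongr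
    _ = (Real.exp 1 * n / s) ^ s := by rw [div_pow, mul_pow]; ring

theorem log_one_add_mul_pow_le {c x : ℝ} {k : ℕ} (hc : 0 ≤ c) (hck : 1 + c ≤ k) (hx0 : 0 < x)
    (hx1 : x ≤ 1) : Real.log (1 + c * x ^ k) ≤ x * Real.log (1 + c) := by
  have hpos : ∀ y : ℝ, 0 < y → 0 < 1 + c * y ^ k := fun y hy => by positivity
  have hd : ∀ y : ℝ, 0 < y → HasDerivAt (fun y => Real.log (1 + c * y ^ k) / y)
      ((c * (k * y ^ (k - 1)) / (1 + c * y ^ k) * y - Real.log (1 + c * y ^ k) * 1) / y ^ 2)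
      y := by
    intro y hy
    exact ((((hasDerivAt_pow k y).const_mul c).const_add 1).log (hpos y hy).ne').div
      (hasDerivAt_id y) hy.ne'
  have hmono : MonotoneOn (fun y => Real.log (1 + c * y ^ k) / y) (Set.Icc x 1) := by
    refine monotoneOn_of_deriv_nonneg (convex_Icc x 1) ?_ ?_ ?_
    · exact fun y hy => (hd y (hx0.trans_le hy.1)).continuousAt.continuousWithinAt
    · rw [interior_Icc]
      exact fun y hy => (hd y (hx0.trans hy.1)).differentiableAt.differentiableWithinAt
    · rw [interior_Icc]
      intro y hy
      have hy0 : 0 < y := hx0.trans hy.1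
      rw [(hd y hy0).deriv]
      refine div_nonneg ?_ (sq_nonneg y)
      have hu := hpos y hy0
      have hk : k ≠ 0 := by
        rintro rfl
        simp at hck; linarith
      have hyk : y ^ (k - 1) * y = y ^ k := pow_sub_one_mul hk y
      have hlog := Real.log_le_sub_one_of_pos hu
      have huk : 1 + c * y ^ k ≤ k := by
        have : y ^ k ≤ 1 := pow_le_one₀ hy0.le hy.2.le
        nlinarith
      have : c * y ^ k ≤ c * (k * y ^ (k - 1)) / (1 + c * y ^ k) * y := by
        have e : c * (k * y ^ (k - 1)) / (1 + c * y ^ k) * y =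
            (c * y ^ k) * k / (1 + c * y ^ k) := by rw [← hyk]; ring
        rw [e, le_div_iff₀ hu]
        exact mul_le_mul_of_nonneg_left huk (by positivity)
      linarith
  have h := hmono (Set.left_mem_Icc.2 hx1) (Set.right_mem_Icc.2 hx1) hx1
  simp only [one_pow, mul_one, div_one] at h
  rw [div_le_iff₀ hx0] at h
  linarith

theorem pred_pow_div_pow_le {n d s : ℕ} {D : ℝ} (hs : s ≤ n) (hD : 0 < D) (hd : D ≤ d) :
    ((d - 1 : ℕ) : ℝ) ^ (n - s) / (d : ℝ) ^ n ≤ (D⁻¹) ^ s := by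
  have hd0 : (0 : ℝ) < d := hD.trans_le hd
  have h1 : ((d - 1 : ℕ) : ℝ) ≤ d := by exact_mod_cast Nat.sub_le d 1
  calc ((d - 1 : ℕ) : ℝ) ^ (n - s) / (d : ℝ) ^ n ≤ (d : ℝ) ^ (n - s) / (d : ℝ) ^ n := by gcongr
    _ = ((d : ℝ)⁻¹) ^ s := by
      rw [inv_pow, div_eq_iff (by positivity), ← div_eq_inv_mul, eq_div_iff (by positivity),
        ← pow_add, Nat.sub_add_cancel hs]
    _ ≤ (D⁻¹) ^ s := by gcongr

theorem rdRatio_term_le {c α r A B : ℝ} {n d m k s : ℕ} (hc : 0 ≤ c) (hr : 0 ≤ r) (hn : 1 ≤ n)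
    (hk : k ≤ n) (hs0 : 0 < s) (hs : s ≤ n) (hd : (n : ℝ) ^ α ≤ d)
    (hm : (m : ℝ) ≤ r * n * Real.log n + 1) (hA : Real.exp 1 * n / s ≤ A)
    (hB : Real.log (1 + c * ((s : ℝ) / n) ^ k) ≤ B * (s / n)) :
    (n.choose s : ℝ) * ((((d - 1 : ℕ) : ℝ) ^ (n - s) / (d : ℝ) ^ n) *
      (1 + c * (s.choose k / n.choose k)) ^ m) ≤
      (1 + c) * (A * (n : ℝ) ^ (r * B - α)) ^ s := by
  have hn0 : (0 : ℝ) < n := by exact_mod_cast hn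
  have hlog : 0 ≤ Real.log n := Real.log_nonneg (by exact_mod_cast hn)
  have hx1 : ((s : ℝ) / n) ^ k ≤ 1 :=
    pow_le_one₀ (by positivity) ((div_le_one hn0).2 (by exact_mod_cast hs))
  have hx0 : 0 ≤ ((s : ℝ) / n) ^ k := by positivity
  have hy : 1 ≤ 1 + c * ((s : ℝ) / n) ^ k := by nlinarith
  have hylog := Real.log_nonneg hy
  have hylog2 : Real.log (1 + c * ((s : ℝ) / n) ^ k) ≤ Real.log (1 + c) :=
    Real.log_le_log (by linarith) (by nlinarith)
  have h1 : (1 + c * ((s.choose k : ℝ) / n.choose k)) ^ m ≤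
      (1 + c) * ((n : ℝ) ^ (r * B)) ^ s := by
    calc (1 + c * ((s.choose k : ℝ) / n.choose k)) ^ m
        ≤ (1 + c * ((s : ℝ) / n) ^ k) ^ m := by
          gcongr
          exact choose_div_choose_le_pow hs hk hn
      _ = Real.exp (m * Real.log (1 + c * ((s : ℝ) / n) ^ k)) := by
          rw [Real.exp_nat_mul, Real.exp_log (by linarith)]
      _ ≤ Real.exp (Real.log (1 + c) + s * (Real.log n * (r * B))) := by
          refine Real.exp_le_exp.2 ?_
          calc (m : ℝ) * Real.log (1 + c * ((s : ℝ) / n) ^ k)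
              ≤ (r * n * Real.log n + 1) * Real.log (1 + c * ((s : ℝ) / n) ^ k) := by gcongr
            _ = Real.log (1 + c * ((s : ℝ) / n) ^ k) +
                r * n * Real.log n * Real.log (1 + c * ((s : ℝ) / n) ^ k) := by ring
            _ ≤ Real.log (1 + c) + r * n * Real.log n * (B * (s / n)) := by gcongr
            _ = _ := by field_simp
      _ = (1 + c) * ((n : ℝ) ^ (r * B)) ^ s := by
          rw [Real.exp_add, Real.exp_log (by linarith), Real.exp_nat_mul,
            Real.rpow_def_of_pos hn0]
  have hA0 : 0 ≤ A := le_trans (by positivity) hA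
  calc _ ≤ A ^ s * ((((n : ℝ) ^ α)⁻¹) ^ s * ((1 + c) * ((n : ℝ) ^ (r * B)) ^ s)) := by
        gcongr
        · exact (choose_le_exp_mul_div_pow n hs0).trans (by gcongr)
        · exact pred_pow_div_pow_le hs (by positivity) hd
    _ = _ := by
        rw [Real.rpow_sub hn0, mul_pow, div_pow, inv_pow]
        ring

theorem sum_choose_mul_pred_pow_div {n d : ℕ} (hd : 0 < d) :
    ∑ s ∈ Finset.range (n + 1), (n.choose s : ℝ) * (((d - 1 : ℕ) : ℝ) ^ (n - s) / (d : ℝ) ^ n) =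
      1 := by
  have hd0 : (0 : ℝ) < d := by exact_mod_cast hd
  have h := add_pow (1 : ℝ) ((d - 1 : ℕ) : ℝ) n
  have h2 : (1 : ℝ) + ((d - 1 : ℕ) : ℝ) = d := by
    rw [Nat.cast_sub hd]; push_cast; ring
  rw [h2] at h
  simp_rw [← mul_div_assoc]
  rw [← Finset.sum_div, div_eq_one_iff_eq (by positivity), h]
  exact Finset.sum_congr rfl fun s _ => by ring

theorem rdRatio_le {c α β δ ε r : ℝ} {n d m k : ℕ} (hc : 0 ≤ c) (hr : 0 ≤ r) (hn : 1 ≤ n)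
    (hk2 : 2 ≤ k) (hk : k ≤ n) (hck : 1 + c ≤ k) (hβ : 0 ≤ β) (hε0 : 0 < ε) (hε1 : ε ≤ 1)
    (hδ1 : r * (c * ε) - α + (1 - β) ≤ -δ) (hδ2 : r * Real.log (1 + c) - α ≤ -δ)
    (hd : (n : ℝ) ^ α ≤ d) (hm : (m : ℝ) ≤ r * n * Real.log n + 1)
    (hsmall : Real.exp 1 / ε * (n : ℝ) ^ (-δ) < 1) :
    rdRatio c n d m k ≤
      Real.exp ((r * n * Real.log n + 1) * (c * (n : ℝ) ^ ((β - 1) * k))) +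
        (1 + c) * (Real.exp 1 / ε * (n : ℝ) ^ (-δ) / (1 - Real.exp 1 / ε * (n : ℝ) ^ (-δ))) := by
  set y := Real.exp 1 / ε * (n : ℝ) ^ (-δ) with hy
  have hn0 : (0 : ℝ) < n := by exact_mod_cast hn
  have hn1 : (1 : ℝ) ≤ n := by exact_mod_cast hn
  have hy0 : 0 < y := by positivity
  have hd0 : 0 < d := by
    have : (0 : ℝ) < d := lt_of_lt_of_le (by positivity) hd
    exact_mod_cast this
  set M := Real.exp ((r * n * Real.log n + 1) * (c * (n : ℝ) ^ ((β - 1) * k))) with hM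
  have hterm : ∀ s ∈ Finset.range (n + 1),
      (n.choose s : ℝ) * ((((d - 1 : ℕ) : ℝ) ^ (n - s) / (d : ℝ) ^ n) *
        (1 + c * (s.choose k / n.choose k)) ^ m) ≤
      (n.choose s : ℝ) * (((d - 1 : ℕ) : ℝ) ^ (n - s) / (d : ℝ) ^ n) * M +
        (1 + c) * (if s = 0 then 0 else y ^ s) := by
    intro s hs
    have hsn : s ≤ n := Nat.lt_succ_iff.1 (Finset.mem_range.1 hs)
    by_cases hsβ : (s : ℝ) < (n : ℝ) ^ β
    · have h0 : 0 ≤ (1 + c) * (if s = 0 then 0 else y ^ s) := by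
        split_ifs <;> positivity
      refine le_trans ?_ (le_add_of_nonneg_right h0)
      rw [← mul_assoc]
      refine mul_le_mul_of_nonneg_left ?_ (by positivity)
      have hx : (s.choose k : ℝ) / n.choose k ≤ (n : ℝ) ^ ((β - 1) * k) := by
        refine (choose_div_choose_le_pow hsn hk hn).trans ?_
        rw [Real.rpow_mul_natCast hn0.le, Real.rpow_sub_one hn0.ne']
        gcongr
      calc (1 + c * ((s.choose k : ℝ) / n.choose k)) ^ m
          ≤ (Real.exp (c * ((s.choose k : ℝ) / n.choose k))) ^ m := by
            gcongr
            linarith [Real.add_one_le_exp (c * ((s.choose k : ℝ) / n.choose k))]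
        _ = Real.exp (m * (c * ((s.choose k : ℝ) / n.choose k))) := by rw [Real.exp_nat_mul]
        _ ≤ M := by
            refine Real.exp_le_exp.2 ?_
            gcongr
    · push Not at hsβ
      have hs1 : (1 : ℝ) ≤ s := (Real.one_le_rpow hn1 hβ).trans hsβ
      have hs0 : 0 < s := by exact_mod_cast hs1
      have hM0 : 0 ≤ (n.choose s : ℝ) * (((d - 1 : ℕ) : ℝ) ^ (n - s) / (d : ℝ) ^ n) * M := by
        positivity
      refine le_trans ?_ (le_add_of_nonneg_left hM0)
      rw [if_neg hs0.ne']
      have hx0 : 0 < (s : ℝ) / n := by positivity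
      have hx1 : (s : ℝ) / n ≤ 1 := (div_le_one hn0).2 (by exact_mod_cast hsn)
      by_cases hsε : (s : ℝ) / n ≤ ε
      · refine (rdRatio_term_le (α := α) (A := Real.exp 1 * (n : ℝ) ^ (1 - β)) (B := c * ε)
          hc hr hn hk hs0 hsn hd hm ?_ ?_).trans ?_
        · rw [Real.rpow_sub hn0, Real.rpow_one, ← mul_div_assoc]
          gcongr
        · have h1 : ((s : ℝ) / n) ^ k ≤ ((s : ℝ) / n) ^ 2 :=
            pow_le_pow_of_le_one hx0.le hx1 hk2
          have h2 : 0 < 1 + c * ((s : ℝ) / n) ^ k := by positivity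
          calc Real.log (1 + c * ((s : ℝ) / n) ^ k) ≤ c * ((s : ℝ) / n) ^ k := by
                linarith [Real.log_le_sub_one_of_pos h2]
            _ ≤ c * ((s : ℝ) / n) ^ 2 := by gcongr
            _ = c * ((s : ℝ) / n) * (s / n) := by ring
            _ ≤ c * ε * (s / n) := by gcongr
        · gcongr
          rw [mul_assoc, ← Real.rpow_add hn0, hy]
          gcongr
          · exact le_div_self (Real.exp_pos 1).le hε0 hε1
          · linarith
      · push Not at hsε
        refine (rdRatio_term_le (α := α) (A := Real.exp 1 / ε) (B := Real.log (1 + c))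
          hc hr hn hk hs0 hsn hd hm ?_ ?_).trans ?_
        · rw [div_le_div_iff₀ (by positivity) hε0, mul_assoc]
          gcongr
          rw [lt_div_iff₀ hn0] at hsε
          linarith
        · rw [mul_comm (Real.log _)]
          exact log_one_add_mul_pow_le hc hck hx0 hx1
        · gcongr
          rw [hy]
          gcongr
  refine (Finset.sum_le_sum hterm).trans ?_
  rw [Finset.sum_add_distrib, ← Finset.sum_mul, sum_choose_mul_pred_pow_div hd0, one_mul,
    ← Finset.mul_sum]
  gcongr
  rw [Finset.sum_range_succ']
  simp only [Nat.add_eq_zero_iff, one_ne_zero, and_false, if_false, if_true, add_zero, pow_succ]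
  rw [← Finset.sum_mul, div_eq_mul_inv, mul_comm y]
  gcongr
  rw [← tsum_geometric_of_lt_one hy0.le hsmall]
  exact (summable_geometric_of_lt_one hy0.le hsmall).sum_le_tsum _ fun i _ => by positivity

theorem tendsto_const_mul_natCast_rpow_neg (K : ℝ) {δ : ℝ} (hδ : 0 < δ) :
    Tendsto (fun n : ℕ => K * (n : ℝ) ^ (-δ)) atTop (𝓝 0) := by
  simpa using ((tendsto_rpow_neg_atTop hδ).comp tendsto_natCast_atTop_atTop).const_mul K

theorem tendsto_natCast_mul_log_mul_rpow {γ : ℝ} (hγ : γ < -1) (r c : ℝ) :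
    Tendsto (fun n : ℕ => (r * n * Real.log n + 1) * (c * (n : ℝ) ^ γ)) atTop (𝓝 0) := by
  have h1 : Tendsto (fun x : ℝ => Real.log x / x ^ (-1 - γ)) atTop (𝓝 0) :=
    (isLittleO_log_rpow_atTop (by linarith)).tendsto_div_nhds_zero
  have h1' := (h1.comp tendsto_natCast_atTop_atTop).const_mul (r * c)
  have h2 := tendsto_const_mul_natCast_rpow_neg c (δ := -γ) (by linarith)
  have h3 := h1'.add h2
  simp only [mul_zero, add_zero] at h3
  refine h3.congr' ?_
  filter_upwards [eventually_gt_atTop 0] with n hn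
  have hn0 : (0 : ℝ) < n := by exact_mod_cast hn
  have h4 : (n : ℝ) * (n : ℝ) ^ γ = ((n : ℝ) ^ (-1 - γ))⁻¹ := by
    rw [← Real.rpow_neg hn0.le, ← Real.rpow_one_add' hn0.le (by linarith)]
    congr 1; ring
  simp only [Function.comp, neg_neg, div_eq_mul_inv]
  rw [← h4]
  ring

theorem natCeil_le_add_one {x : ℝ} (hx : 0 ≤ x) : (⌈x⌉₊ : ℝ) ≤ x + 1 :=
  (Nat.ceil_lt_add_one hx).le

theorem rdPr_exists_le_pow {α p r : ℝ} {n k : ℕ} (hp0 : 0 < p) (hp1 : p < 1) (hα : 0 < α)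
    (hn : 1 ≤ n) (hk : k ≤ n) :
    rdPr p n ⌈(n : ℝ) ^ α⌉₊ ⌈r * n * Real.log n⌉₊ k
      (fun ω => ∃ a : Fin n → Fin ⌈(n : ℝ) ^ α⌉₊,
        ∀ j : Fin ⌈r * n * Real.log n⌉₊, rdCompat ω j a) ≤
      (2 * (n : ℝ) ^ (α + r * Real.log (1 - p))) ^ n := by
  have hn0 : (0 : ℝ) < n := by exact_mod_cast hn
  have hn1 : (1 : ℝ) ≤ n := by exact_mod_cast hn
  have hq : 0 < 1 - p := by linarith
  refine (rdPr_exists_le hp0.le hp1.le hk).trans ?_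
  have h1 : (⌈(n : ℝ) ^ α⌉₊ : ℝ) ≤ 2 * (n : ℝ) ^ α := by
    have := natCeil_le_add_one (x := (n : ℝ) ^ α) (by positivity)
    have := Real.one_le_rpow hn1 hα.le
    linarith
  have h2 : (1 - p) ^ ⌈r * n * Real.log n⌉₊ ≤ ((n : ℝ) ^ (r * Real.log (1 - p))) ^ n := by
    rw [← Real.rpow_natCast]
    refine (Real.rpow_le_rpow_of_exponent_ge hq (by linarith) (Nat.le_ceil _)).trans_eq ?_
    rw [Real.rpow_def_of_pos hq, Real.rpow_def_of_pos hn0, ← Real.exp_nat_mul]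
    congr 1; ring
  rw [Real.rpow_add hn0, ← mul_assoc, mul_pow]
  gcongr

end Analysis

/-- Let `p ∈ (0,1)` and `k ≥ 2` be constants with `k ≥ 1/(1-p)`, let `α > 1/k`, `r > 0`,
and let `r_cr = -α/ln(1-p)`. The probability that a random instance of Model RD (with
domain size `d = ⌈n^α⌉` and `m = ⌈r n ln n⌉` constraints) is satisfiable — i.e. admits an
assignment of domain values to all variables compatible with every constraint — tends, as
`n → ∞`, to `1` if `r < r_cr` and to `0` if `r > r_cr`. -/
theorem rd_satisfiability_threshold (α p r : ℝ) (k : ℕ) (hp0 : 0 < p) (hp1 : p < 1)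
    (hk : 2 ≤ k) (hkp : 1 / (1 - p) ≤ (k : ℝ)) (hα : 1 / (k : ℝ) < α) (hr0 : 0 < r) :
    (r < -α / Real.log (1 - p) →
      Filter.Tendsto
        (fun n : ℕ => rdPr p n ⌈(n : ℝ) ^ α⌉₊ ⌈r * n * Real.log n⌉₊ k
          (fun ω => ∃ a : Fin n → Fin ⌈(n : ℝ) ^ α⌉₊,
            ∀ j : Fin ⌈r * n * Real.log n⌉₊, rdCompat ω j a))
        Filter.atTop (nhds 1)) ∧
    (-α / Real.log (1 - p) < r →
      Filter.Tendsto
        (fun n : ℕ => rdPr p n ⌈(n : ℝ) ^ α⌉₊ ⌈r * n * Real.log n⌉₊ k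
          (fun ω => ∃ a : Fin n → Fin ⌈(n : ℝ) ^ α⌉₊,
            ∀ j : Fin ⌈r * n * Real.log n⌉₊, rdCompat ω j a))
        Filter.atTop (nhds 0)) := by
  have hq : 0 < 1 - p := by linarith
  have hk0 : (0 : ℝ) < k := by exact_mod_cast (by omega : 0 < k)
  have hk1 : (1 : ℝ) < k := by exact_mod_cast (by omega : 1 < k)
  have hα0 : 0 < α := lt_trans (by positivity) hα
  have hlogq : Real.log (1 - p) < 0 := Real.log_neg hq (by linarith)
  refine ⟨fun hr => ?_, fun hr => ?_⟩
  · set c := p / (1 - p) with hc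
    have hc0 : 0 < c := by positivity
    have h1c : 1 + c = (1 - p)⁻¹ := by rw [hc]; field_simp; ring
    have hck : 1 + c ≤ k := by rw [h1c, ← one_div]; exact hkp
    have hrc : r * Real.log (1 + c) < α := by
      rw [h1c, Real.log_inv]
      rw [lt_div_iff_of_neg hlogq] at hr
      linarith
    have hik : 1 / (k : ℝ) < 1 := by rw [div_lt_one hk0]; exact hk1
    obtain ⟨β, hβ1, hβ2⟩ : ∃ β, max 0 (1 - α) < β ∧ β < 1 - 1 / (k : ℝ) :=
      exists_between (max_lt (by linarith) (by linarith))
    have hβ0 : 0 < β := (le_max_left _ _).trans_lt hβ1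
    have hβα : 1 - α < β := (le_max_right _ _).trans_lt hβ1
    set ε := min 1 ((α + β - 1) / (2 * (r * c))) with hε
    have hε0 : 0 < ε := lt_min one_pos (div_pos (by linarith) (by positivity))
    have hrε : r * (c * ε) ≤ (α + β - 1) / 2 := by
      have h : ε ≤ (α + β - 1) / (2 * (r * c)) := min_le_right _ _
      rw [le_div_iff₀ (by positivity)] at h
      linarith
    set δ := min ((α + β - 1) / 2) (α - r * Real.log (1 + c)) with hδ
    have hδ0 : 0 < δ := lt_min (by linarith) (by linarith)
    have hδ1 : δ ≤ (α + β - 1) / 2 := min_le_left _ _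
    have hδ2 : δ ≤ α - r * Real.log (1 + c) := min_le_right _ _
    have hγ : (β - 1) * k < -1 := by
      have h : β - 1 < -1 / k := by rw [neg_div]; linarith
      rwa [lt_div_iff₀ hk0] at h
    have hy := tendsto_const_mul_natCast_rpow_neg (Real.exp 1 / ε) hδ0
    have hB : Filter.Tendsto (fun n : ℕ =>
        (Real.exp ((r * n * Real.log n + 1) * (c * (n : ℝ) ^ ((β - 1) * k))) +
          (1 + c) * (Real.exp 1 / ε * (n : ℝ) ^ (-δ) /
            (1 - Real.exp 1 / ε * (n : ℝ) ^ (-δ))))⁻¹) Filter.atTop (nhds 1) := by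
      have h1 := (Real.continuous_exp.tendsto 0).comp (tendsto_natCast_mul_log_mul_rpow hγ r c)
      have h2 := (hy.div (hy.const_sub 1) (by norm_num)).const_mul (1 + c)
      simpa using (h1.add h2).inv₀ (by simp)
    refine tendsto_of_tendsto_of_tendsto_of_le_of_le' hB tendsto_const_nhds ?_ ?_
    · filter_upwards [Filter.eventually_ge_atTop k, Filter.eventually_ge_atTop 1,
        hy.eventually_lt_const one_pos] with n hkn hn hsmall
      have hn0 : (0 : ℝ) < n := by exact_mod_cast hn
      have hlog : 0 ≤ Real.log n := Real.log_nonneg (by exact_mod_cast hn)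
      have hle := rdRatio_le (c := c) (α := α) (β := β) (δ := δ) (ε := ε) (r := r)
        (d := ⌈(n : ℝ) ^ α⌉₊) (m := ⌈r * n * Real.log n⌉₊) hc0.le hr0.le hn hk hkn hck hβ0.le
        hε0 (min_le_left _ _) (by linarith) (by linarith) (Nat.le_ceil _)
        (natCeil_le_add_one (by positivity)) hsmall
      have hone := one_le_rdPr_exists_mul_rdRatio hp0.le hp1 (n := n) (d := ⌈(n : ℝ) ^ α⌉₊)
        (m := ⌈r * n * Real.log n⌉₊) hkn (Nat.ceil_pos.2 (by positivity))
      have hpos : 0 ≤ rdPr p n ⌈(n : ℝ) ^ α⌉₊ ⌈r * n * Real.log n⌉₊ k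
          (fun ω => ∃ a : Fin n → Fin ⌈(n : ℝ) ^ α⌉₊, ∀ j, rdCompat ω j a) :=
        Finset.sum_nonneg fun ω _ => rdWeight_nonneg hp0.le hp1.le ω
      have hB1 := hone.trans (mul_le_mul_of_nonneg_left hle hpos)
      exact (inv_le_iff_one_le_mul₀ (pos_of_mul_pos_right (one_pos.trans_le hB1) hpos)).2 hB1
    · filter_upwards [Filter.eventually_ge_atTop k] with n hkn
      exact rdPr_le_one hp0.le hp1.le hkn _
  · set η := -(α + r * Real.log (1 - p)) with hη
    have hη0 : 0 < η := by
      rw [div_lt_iff_of_neg hlogq] at hr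
      linarith
    have hy := tendsto_const_mul_natCast_rpow_neg 2 hη0
    refine tendsto_of_tendsto_of_tendsto_of_le_of_le' tendsto_const_nhds hy ?_ ?_
    · exact Filter.Eventually.of_forall fun n =>
        Finset.sum_nonneg fun ω _ => rdWeight_nonneg hp0.le hp1.le ω
    · filter_upwards [Filter.eventually_ge_atTop k, Filter.eventually_ge_atTop 1,
        hy.eventually_lt_const one_pos] with n hkn hn hsmall
      refine (rdPr_exists_le_pow hp0 hp1 hα0 hn hkn).trans ?_
      rw [hη, neg_neg] at hsmall ⊢
      exact pow_le_of_le_one (by positivity) hsmall.le (by omega)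
end
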